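/- arXiv:2410.11515 — 2 statements merged into one kernel-verified Lean document; each statement's English description precedes it below -/
import Mathlib

section
/- Fix α > 1, β > 0, h > 0, c > 0, d ≥ 0, and N ≥ 1, and let the random fields be i.i.d. symmetric Bernoulli (P(h_i = 1) = P(h_i = −1) = 1/2). Then the quenched average of the squared total magnetization satisfies the recurrence inequality f_N ≥ f_{N−1} − (1/(β b_N))·( 1/(c β^{d−1}) + log(1 + (c β^d b_N)^{1/2}) + E[ max_{1≤k≤r_N} log( Z_{k,1}(h₁)/Z_{k,2}(h₂) ) ] ). -/
open MeasureTheory ProbabilityTheory Filter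
open scoped Classical

noncomputable section

/-- The spin value (±1) of a Boolean configuration entry. -/
def spin (b : Bool) : ℝ := if b then 1 else -1

/-- The total spin `S_{n,1} = Σ_i σ_i` of a configuration of `2^n` spins. -/
def totalSpin (n : ℕ) (σ : Fin (2^n) → Bool) : ℝ := ∑ i, spin (σ i)

/-- The Dyson hierarchical Hamiltonian `H_N`, defined recursively:
`H_0 = 0`, `H_{N}(σ) = H_{N-1}(σ₁) + H_{N-1}(σ₂) - 2^{-αN} Σ_{i,j} σ_i σ_j`. -/
def dysonH (α : ℝ) : (N : ℕ) → (Fin (2^N) → Bool) → ℝ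
  | 0, _ => 0
  | (N+1), σ =>
      dysonH α N (fun i => σ ⟨i.1, by have := i.2; rw [pow_succ]; omega⟩)
    + dysonH α N (fun i => σ ⟨2^N + i.1, by have := i.2; rw [pow_succ]; omega⟩)
    - (2:ℝ) ^ (-(α * ((N:ℝ)+1))) *
        ∑ i : Fin (2^(N+1)), ∑ j : Fin (2^(N+1)), spin (σ i) * spin (σ j)

/-- The random-field Hamiltonian `H_N^{RF}(σ) = H_N(σ) - h Σ_i h_i σ_i`,
where `fh` is the field strength and `η` the realization of the random fields. -/
def dysonHRF (α fh : ℝ) (N : ℕ) (η : Fin (2^N) → ℝ) (σ : Fin (2^N) → Bool) : ℝ :=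
  dysonH α N σ - fh * ∑ i, η i * spin (σ i)

/-- The Gibbs average `⟨F⟩_N` with weight `exp(-β H_N^{RF}(σ))`. -/
def gibbs (α β fh : ℝ) (N : ℕ) (η : Fin (2^N) → ℝ) (F : (Fin (2^N) → Bool) → ℝ) : ℝ :=
  (∑ σ, F σ * Real.exp (-β * dysonHRF α fh N η σ)) /
    ∑ σ, Real.exp (-β * dysonHRF α fh N η σ)

/-- The law of `n` i.i.d. standard Gaussian random fields. -/
def gaussianFields (n : ℕ) : Measure (Fin n → ℝ) :=
  Measure.pi fun _ => gaussianReal 0 1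

/-- Expectation with respect to `n` i.i.d. symmetric Bernoulli (±1) random fields,
i.e. the uniform average over `{-1,+1}^n`. -/
def bernoulliExp (n : ℕ) (F : (Fin n → ℝ) → ℝ) : ℝ :=
  ((2:ℝ)^n)⁻¹ * ∑ ε : Fin n → Bool, F (fun i => spin (ε i))

/-- `f_N = 2^{-2N} E[⟨S_{N,1}²⟩_N]` with i.i.d. standard Gaussian random fields. -/
def fG (α β fh : ℝ) (N : ℕ) : ℝ :=
  ((2:ℝ)^(2*N))⁻¹ *
    ∫ η, gibbs α β fh N η (fun σ => (totalSpin N σ)^2) ∂ gaussianFields (2^N)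

/-- `f_N = 2^{-2N} E[⟨S_{N,1}²⟩_N]` with i.i.d. symmetric Bernoulli random fields. -/
def fB (α β fh : ℝ) (N : ℕ) : ℝ :=
  ((2:ℝ)^(2*N))⁻¹ *
    bernoulliExp (2^N) (fun η => gibbs α β fh N η (fun σ => (totalSpin N σ)^2))

/-- `b_n = 2^{(2-α)n}`. -/
def bcoef (α : ℝ) (n : ℕ) : ℝ := (2:ℝ) ^ (((2:ℝ) - α) * n)

/-- The first half `(h_1, …, h_{2^{N-1}})` of the random fields. -/
def half1 (N : ℕ) (η : Fin (2^N) → ℝ) : Fin (2^(N-1)) → ℝ :=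
  fun i => η ⟨i.1, lt_of_lt_of_le i.2 (Nat.pow_le_pow_right (by norm_num) (Nat.sub_le N 1))⟩

/-- The second half `(h_{2^{N-1}+1}, …, h_{2^N})` of the random fields. -/
def half2 (N : ℕ) (η : Fin (2^N) → ℝ) : Fin (2^(N-1)) → ℝ :=
  fun i => if hlt : 2^(N-1) + i.1 < 2^N then η ⟨2^(N-1) + i.1, hlt⟩ else 0

/-- Membership in the `k`-th of the `r` equal subintervals `I_k` of `[-2^{N-1}, 2^{N-1}]`. -/
def inBlock (N r k : ℕ) (x : ℝ) : Prop :=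
  -(2:ℝ)^(N-1) + ((k:ℝ)-1) * ((2:ℝ)^N / r) ≤ x ∧
    x ≤ -(2:ℝ)^(N-1) + (k:ℝ) * ((2:ℝ)^N / r)

/-- The restricted partition function
`Z_k(η) = Σ_{σ : S_{N-1} ∈ I_k} exp(-β H_{N-1}^{RF}(σ) + 2β b_N 2^{-2N} S_{N-1}²)`,
on `2^{N-1}` spins with fields `η`. Both `Z_{k,1}` and `Z_{k,2}` are this function,
applied to the first resp. second half of the random fields. -/
def Zres (α β fh : ℝ) (N r k : ℕ) (η : Fin (2^(N-1)) → ℝ) : ℝ :=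
  ∑ σ : Fin (2^(N-1)) → Bool,
    if inBlock N r k (totalSpin (N-1) σ) then
      Real.exp (-β * dysonHRF α fh (N-1) η σ
        + 2 * β * bcoef α N * ((2:ℝ)^(2*N))⁻¹ * (totalSpin (N-1) σ)^2)
    else 0

/-- `g_k = log (Z_{k,1}(h₁) / Z_{k,2}(h₂))` as a function of all the random fields. -/
def gk (α β fh : ℝ) (N r k : ℕ) (η : Fin (2^N) → ℝ) : ℝ :=
  Real.log (Zres α β fh N r k (half1 N η) / Zres α β fh N r k (half2 N η))

/-- `max_{1 ≤ k ≤ r} g_k`. -/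
def maxgk (α β fh : ℝ) (N r : ℕ) (hr : 1 ≤ r) (η : Fin (2^N) → ℝ) : ℝ :=
  (Finset.Icc 1 r).sup' (Finset.nonempty_Icc.mpr hr) (fun k => gk α β fh N r k η)

/-- The sum of the spins in the `B`-th consecutive block of size `2^n` (out of `2^{N-n}`). -/
def blockSum (N n : ℕ) (σ : Fin (2^N) → Bool) (B : Fin (2^(N-n))) : ℝ :=
  ∑ j : Fin (2^n), if hlt : B.1 * 2^n + j.1 < 2^N then spin (σ ⟨B.1 * 2^n + j.1, hlt⟩) else 0

/-- The generalized pressure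
`P_N(v_N, …, v_1) = log Σ_σ exp(Σ_{n=1}^N v_n Σ_B (Σ_{i∈B} σ_i)² + β h Σ_i h_i σ_i)`
for a given realization `η` of the random fields; the quenched pressure is its
expectation over the fields. -/
def pressure (β fh : ℝ) (N : ℕ) (v : ℕ → ℝ) (η : Fin (2^N) → ℝ) : ℝ :=
  Real.log (∑ σ : Fin (2^N) → Bool,
    Real.exp ((∑ n ∈ Finset.Icc 1 N, v n * ∑ B : Fin (2^(N-n)), (blockSum N n σ B)^2)
      + β * fh * ∑ i, η i * spin (σ i)))

/-- The couplings `v_n = β b_n 2^{-2n}` corresponding to `-β H_N`. -/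
def vcoup (α β : ℝ) (n : ℕ) : ℝ := β * bcoef α n * ((2:ℝ)^(2*n))⁻¹

/-- `f_N = 2^{-2N} ⟨S_{N,1}²⟩_N` without random field. -/
def fNoField (α β : ℝ) (N : ℕ) : ℝ :=
  ((2:ℝ)^(2*N))⁻¹ * gibbs α β 0 N (fun _ => 0) (fun σ => (totalSpin N σ)^2)

/-- The `p`-th term of the series bounding `1 - f_N` from above. -/
def seriesTerm (α β fh c : ℝ) (p : ℕ) : ℝ :=
  (1/(β * bcoef α p)) * (β/c + Real.log (2 * Real.sqrt (c * bcoef α p))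
    + β * fh * (2:ℝ)^((p:ℝ)/2) *
      Real.log (2 * Real.sqrt (c * bcoef α p) * (1 + Real.sqrt (2*Real.pi*Real.exp 1))))

lemma aux_jensen {A : Type*} [Fintype A] [Nonempty A] (p F : A → ℝ) (hp : ∀ a, 0 < p a) :
    (∑ a, F a * p a) / (∑ a, p a) ≤ Real.log (∑ a, p a * Real.exp (F a)) - Real.log (∑ a, p a) := by
  have hP : 0 < ∑ a, p a := Finset.sum_pos (fun a _ => hp a) Finset.univ_nonempty
  set m := (∑ a, F a * p a) / (∑ a, p a) with hm
  have hmP : m * ∑ a, p a = ∑ a, F a * p a := by rw [hm]; field_simp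
  have h1 : Real.exp m * ∑ a, p a ≤ ∑ a, p a * Real.exp (F a) := by
    have h2 : ∀ a, p a * (Real.exp m * (F a - m + 1)) ≤ p a * Real.exp (F a) := by
      intro a
      have h3 := Real.add_one_le_exp (F a - m)
      have h4 : Real.exp (F a) = Real.exp m * Real.exp (F a - m) := by
        rw [← Real.exp_add]; congr 1; ring
      rw [h4]
      have := hp a
      gcongr
    have h5 := Finset.sum_le_sum (fun a (_ : a ∈ Finset.univ) => h2 a)
    have h6 : ∑ a, p a * (Real.exp m * (F a - m + 1)) = Real.exp m * ∑ a, p a := by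
      have : ∀ a, p a * (Real.exp m * (F a - m + 1))
          = Real.exp m * (F a * p a) - Real.exp m * m * p a + Real.exp m * p a := by
        intro a; ring
      simp_rw [this]
      rw [Finset.sum_add_distrib, Finset.sum_sub_distrib, ← Finset.mul_sum, ← Finset.mul_sum,
        ← Finset.mul_sum, ← hmP]
      ring
    linarith
  have h7 := Real.log_le_log (by positivity) h1
  rw [Real.log_mul (Real.exp_pos _).ne' hP.ne', Real.log_exp] at h7
  linarith

lemma aux_core {A : Type*} [Fintype A] (w1 w2 : A → ℝ) (hw1 : ∀ a, 0 < w1 a)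
    (hw2 : ∀ a, 0 < w2 a) (P : ℕ → A → Prop) (κ : A → ℕ) (r : ℕ)
    (hκ : ∀ a, κ a ∈ Finset.Icc 1 r) (hP : ∀ a, P (κ a) a) (C δ : ℝ) (hC : 0 < C)
    (hZ : ∀ k ∈ Finset.Icc 1 r, (∑ a, if P k a then w1 a else 0) ≤
      C * ∑ a, if P k a then w2 a else 0)
    (D : A → A → ℝ) (hD : ∀ k a b, P k a → P k b → D a b ≤ δ) :
    (∑ a, w1 a)^2 ≤ r * C * Real.exp δ * ∑ a, ∑ b, w1 a * w2 b * Real.exp (-(D a b)) := by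
  set x : ℕ → ℝ := fun k => ∑ a with κ a = k, w1 a with hx
  set V : ℕ → ℝ := fun k => ∑ b, if P k b then w2 b else 0 with hV
  have hx0 : ∀ k, 0 ≤ x k := fun k => Finset.sum_nonneg (fun a _ => (hw1 a).le)
  have h1 : ∑ k ∈ Finset.Icc 1 r, x k = ∑ a, w1 a :=
    Finset.sum_fiberwise_of_maps_to (fun a _ => hκ a) _
  have h2 : (∑ a, w1 a)^2 ≤ r * ∑ k ∈ Finset.Icc 1 r, (x k)^2 := by
    rw [← h1]
    have := sq_sum_le_card_mul_sum_sq (s := Finset.Icc 1 r) (f := x)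
    simpa using this
  have h3 : ∀ k ∈ Finset.Icc 1 r, (x k)^2 ≤ C * (x k * V k) := by
    intro k hk
    have h4 : x k ≤ ∑ a, if P k a then w1 a else 0 := by
      rw [hx]; simp only [Finset.sum_filter]
      apply Finset.sum_le_sum
      intro a _
      by_cases h : κ a = k
      · have := hP a
        rw [h] at this
        simp [h, this]
      · simp only [h, if_false]
        split_ifs
        · exact (hw1 a).le
        · exact le_rfl
    have h5 := h4.trans (hZ k hk)
    calc (x k)^2 = x k * x k := by ring
      _ ≤ x k * (C * V k) := mul_le_mul_of_nonneg_left h5 (hx0 k)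
      _ = _ := by ring
  have h6 : ∑ k ∈ Finset.Icc 1 r, x k * V k = ∑ a, w1 a * V (κ a) := by
    rw [← Finset.sum_fiberwise_of_maps_to (s := Finset.univ) (fun a _ => hκ a)]
    apply Finset.sum_congr rfl
    intro k _
    rw [hx]; simp only [Finset.sum_mul]
    apply Finset.sum_congr rfl
    intro a ha
    rw [(Finset.mem_filter.mp ha).2]
  have h7 : ∑ a, w1 a * V (κ a) ≤
      Real.exp δ * ∑ a, ∑ b, w1 a * w2 b * Real.exp (-(D a b)) := by
    rw [Finset.mul_sum]
    apply Finset.sum_le_sum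
    intro a _
    rw [hV]; simp only [Finset.mul_sum]
    apply Finset.sum_le_sum
    intro b _
    have ha := hw1 a
    have hb := hw2 b
    split_ifs with h
    · have h8 := hD _ a b (hP a) h
      have h9 : 1 ≤ Real.exp δ * Real.exp (-(D a b)) := by
        rw [← Real.exp_add]; apply Real.one_le_exp; linarith
      calc w1 a * w2 b = w1 a * w2 b * 1 := by ring
        _ ≤ w1 a * w2 b * (Real.exp δ * Real.exp (-(D a b))) := by gcongr
        _ = _ := by ring
    · rw [mul_zero]; positivity
  calc _ ≤ _ := h2
    _ ≤ r * (C * ∑ a, w1 a * V (κ a)) := by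
      rw [← h6, Finset.mul_sum _ _ C]
      gcongr with k hk
      exact h3 k hk
    _ ≤ r * (C * (Real.exp δ * ∑ a, ∑ b, w1 a * w2 b * Real.exp (-(D a b)))) := by gcongr
    _ = _ := by ring

lemma aux_block (M r : ℕ) (hr : 1 ≤ r) (x : ℝ) (h1 : -(2:ℝ)^M ≤ x) (h2 : x ≤ (2:ℝ)^M) :
    ∃ k ∈ Finset.Icc 1 r, inBlock (M+1) r k x := by
  have hr0 : (0:ℝ) < r := by exact_mod_cast hr
  set l : ℝ := (2:ℝ)^(M+1) / r with hl
  have hl0 : 0 < l := by positivity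
  have hlr : l * r = 2 * (2:ℝ)^M := by rw [hl]; field_simp; ring
  set y := (x + (2:ℝ)^M) / l with hy
  have hyx : y * l = x + (2:ℝ)^M := by rw [hy]; field_simp
  have hy0 : 0 ≤ y := div_nonneg (by linarith) hl0.le
  have hyr : y ≤ r := by rw [hy, div_le_iff₀ hl0]; nlinarith
  have key : ∀ k : ℕ, (k:ℝ) - 1 ≤ y → y ≤ k → inBlock (M+1) r k x := by
    intro k ha hb
    unfold inBlock
    rw [Nat.add_sub_cancel, ← hl]
    constructor <;> nlinarith
  by_cases h0 : y = 0
  · exact ⟨1, by simp [hr], key 1 (by simp [h0]) (by simp [h0])⟩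
  · have hpos : 0 < y := lt_of_le_of_ne hy0 (Ne.symm h0)
    refine ⟨⌈y⌉₊, ?_, key _ ?_ (Nat.le_ceil y)⟩
    · rw [Finset.mem_Icc]
      exact ⟨Nat.ceil_pos.mpr hpos, Nat.ceil_le.mpr hyr⟩
    · have := Nat.ceil_lt_add_one hy0
      linarith

def Lh {X : Type*} (M : ℕ) (σ : Fin (2^(M+1)) → X) : Fin (2^M) → X :=
  fun i => σ ⟨i.1, by have := i.2; rw [pow_succ]; omega⟩

def Rh {X : Type*} (M : ℕ) (σ : Fin (2^(M+1)) → X) : Fin (2^M) → X :=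
  fun i => σ ⟨2^M + i.1, by have := i.2; rw [pow_succ]; omega⟩

lemma aux_idx (M : ℕ) : 2^M + 2^M = 2^(M+1) := by rw [pow_succ]; omega

def splitE (X : Type*) (M : ℕ) :
    (Fin (2^(M+1)) → X) ≃ (Fin (2^M) → X) × (Fin (2^M) → X) :=
  (Equiv.arrowCongr ((finSumFinEquiv (m := 2^M) (n := 2^M)).trans
    (finCongr (aux_idx M))) (Equiv.refl X)).symm.trans (Equiv.sumArrowEquivProdArrow _ _ _)

lemma splitE_apply (X : Type*) (M : ℕ) (σ : Fin (2^(M+1)) → X) :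
    splitE X M σ = (Lh M σ, Rh M σ) := rfl

lemma sum_split (M : ℕ) (f : Fin (2^(M+1)) → ℝ) :
    ∑ i, f i = ∑ i, Lh M f i + ∑ i, Rh M f i := by
  rw [← Equiv.sum_comp ((finSumFinEquiv (m := 2^M) (n := 2^M)).trans (finCongr (aux_idx M))) f,
    Fintype.sum_sum_type]
  rfl

lemma sum_conf (M : ℕ) (F : (Fin (2^M) → Bool) → (Fin (2^M) → Bool) → ℝ) :
    ∑ σ, F (Lh M σ) (Rh M σ) = ∑ a, ∑ b, F a b := by
  rw [← Fintype.sum_prod_type', ← Equiv.sum_comp (splitE Bool M)]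
  rfl

lemma totalSpin_split (M : ℕ) (σ : Fin (2^(M+1)) → Bool) :
    totalSpin (M+1) σ = totalSpin M (Lh M σ) + totalSpin M (Rh M σ) := by
  unfold totalSpin
  rw [sum_split]; rfl

lemma abs_totalSpin (M : ℕ) (σ : Fin (2^M) → Bool) : |totalSpin M σ| ≤ (2:ℝ)^M := by
  unfold totalSpin
  refine (Finset.abs_sum_le_sum_abs _ _).trans ?_
  have : ∀ i, |spin (σ i)| = 1 := by
    intro i; unfold spin; split_ifs <;> simp
  simp [this]

lemma half1_eq (M : ℕ) (η : Fin (2^(M+1)) → ℝ) : half1 (M+1) η = Lh M η := rfl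

lemma half2_eq (M : ℕ) (η : Fin (2^(M+1)) → ℝ) : half2 (M+1) η = Rh M η := by
  funext i
  have h : 2^M + i.1 < 2^(M+1) := by
    have h1 : i.1 < 2^M := i.2
    rw [pow_succ]; omega
  have h' : 2^(M+1-1) + i.1 < 2^(M+1) := h
  unfold half2
  rw [dif_pos h']
  rfl

lemma vcoup_eq (α : ℝ) (M : ℕ) :
    (2:ℝ) ^ (-(α * ((M:ℝ)+1))) = bcoef α (M+1) * ((2:ℝ)^(2*(M+1)))⁻¹ := by
  unfold bcoef
  rw [← Real.rpow_natCast, ← Real.rpow_neg (by norm_num), ← Real.rpow_add (by norm_num)]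
  congr 1
  push_cast
  ring

lemma HRF_split (α fh : ℝ) (M : ℕ) (η : Fin (2^(M+1)) → ℝ) (σ : Fin (2^(M+1)) → Bool) :
    dysonHRF α fh (M+1) η σ = dysonHRF α fh M (Lh M η) (Lh M σ)
      + dysonHRF α fh M (Rh M η) (Rh M σ)
      - bcoef α (M+1) * ((2:ℝ)^(2*(M+1)))⁻¹ * (totalSpin (M+1) σ)^2 := by
  unfold dysonHRF
  rw [sum_split M (fun i => η i * spin (σ i))]
  have h : dysonH α (M+1) σ = dysonH α M (Lh M σ) + dysonH α M (Rh M σ)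
      - (2:ℝ) ^ (-(α * ((M:ℝ)+1))) * (totalSpin (M+1) σ)^2 := by
    rw [dysonH, totalSpin, sq, Finset.sum_mul_sum]; rfl
  rw [h, vcoup_eq]
  have h2 : ∀ i, Lh M (fun i => η i * spin (σ i)) i = Lh M η i * spin (Lh M σ i) := fun _ => rfl
  have h3 : ∀ i, Rh M (fun i => η i * spin (σ i)) i = Rh M η i * spin (Rh M σ i) := fun _ => rfl
  simp_rw [h2, h3]
  ring

lemma exp_L (M : ℕ) (G : (Fin (2^M) → ℝ) → ℝ) :
    bernoulliExp (2^(M+1)) (fun η => G (Lh M η)) = bernoulliExp (2^M) G := by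
  unfold bernoulliExp
  have := sum_conf M (fun a _ => G (fun i => spin (a i)))
  have h2 : ∑ ε : Fin (2^(M+1)) → Bool, G (Lh M (fun i => spin (ε i)))
    = ∑ a : Fin (2^M) → Bool, ∑ b : Fin (2^M) → Bool, G (fun i => spin (a i)) := this
  rw [h2, ← aux_idx M, pow_add]
  simp only [Finset.sum_const, Finset.card_univ, Fintype.card_fun, Fintype.card_bool,
    Fintype.card_fin, nsmul_eq_mul, ← Finset.mul_sum]
  push_cast
  field_simp

lemma exp_R (M : ℕ) (G : (Fin (2^M) → ℝ) → ℝ) :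
    bernoulliExp (2^(M+1)) (fun η => G (Rh M η)) = bernoulliExp (2^M) G := by
  unfold bernoulliExp
  have := sum_conf M (fun _ b => G (fun i => spin (b i)))
  have h2 : ∑ ε : Fin (2^(M+1)) → Bool, G (Rh M (fun i => spin (ε i)))
    = ∑ a : Fin (2^M) → Bool, ∑ b : Fin (2^M) → Bool, G (fun i => spin (b i)) := this
  rw [h2, ← aux_idx M, pow_add]
  simp only [Finset.sum_const, Finset.card_univ, Fintype.card_fun, Fintype.card_bool,
    Fintype.card_fin, nsmul_eq_mul]
  push_cast
  field_simp

lemma exp_mono (n : ℕ) (F G : (Fin n → ℝ) → ℝ) (h : ∀ η, F η ≤ G η) :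
    bernoulliExp n F ≤ bernoulliExp n G := by
  unfold bernoulliExp
  gcongr
  exact h _

lemma exp_add (n : ℕ) (F G : (Fin n → ℝ) → ℝ) :
    bernoulliExp n (fun η => F η + G η) = bernoulliExp n F + bernoulliExp n G := by
  unfold bernoulliExp
  rw [Finset.sum_add_distrib, mul_add]

lemma exp_smul (n : ℕ) (t : ℝ) (F : (Fin n → ℝ) → ℝ) :
    bernoulliExp n (fun η => t * F η) = t * bernoulliExp n F := by
  unfold bernoulliExp
  rw [← Finset.mul_sum]; ring

lemma exp_const (n : ℕ) (t : ℝ) : bernoulliExp n (fun _ => t) = t := by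
  unfold bernoulliExp
  simp

def Zf (α β fh : ℝ) (M : ℕ) (η : Fin (2^M) → ℝ) : ℝ :=
  ∑ σ, Real.exp (-β * dysonHRF α fh M η σ)

lemma Zf_pos (α β fh : ℝ) (M : ℕ) (η : Fin (2^M) → ℝ) : 0 < Zf α β fh M η :=
  Finset.sum_pos (fun _ _ => Real.exp_pos _) Finset.univ_nonempty

lemma Zres_le (α β fh : ℝ) (M r : ℕ) (hr : 1 ≤ r) (η : Fin (2^(M+1)) → ℝ) (k : ℕ)
    (hk : k ∈ Finset.Icc 1 r) :
    Zres α β fh (M+1) r k (Lh M η) ≤ Real.exp (maxgk α β fh (M+1) r hr η) *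
      Zres α β fh (M+1) r k (Rh M η) := by
  have hg : gk α β fh (M+1) r k η ≤ maxgk α β fh (M+1) r hr η :=
    Finset.le_sup' (fun k => gk α β fh (M+1) r k η) hk
  unfold gk at hg
  rw [half1_eq, half2_eq] at hg
  by_cases hne : ∃ σ : Fin (2^M) → Bool, inBlock (M+1) r k (totalSpin M σ)
  · obtain ⟨σ, hσ⟩ := hne
    have hpos : ∀ η', 0 < Zres α β fh (M+1) r k η' := by
      intro η'
      unfold Zres
      apply Finset.sum_pos'
      · intro a _
        split_ifs
        · positivity
        · exact le_rfl
      · refine ⟨σ, Finset.mem_univ _, ?_⟩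
        rw [if_pos]
        · positivity
        · exact hσ
    have h1 := hpos (Lh M η)
    have h2 := hpos (Rh M η)
    rw [Real.log_le_iff_le_exp (div_pos h1 h2), div_le_iff₀ h2] at hg
    exact hg
  · push Not at hne
    have hz : ∀ η', Zres α β fh (M+1) r k η' = 0 := by
      intro η'
      unfold Zres
      apply Finset.sum_eq_zero
      intro a _
      exact if_neg (hne a)
    rw [hz, hz]; simp

lemma aux_point (α β fh : ℝ) (hβ : 0 < β) (M r : ℕ) (hr : 1 ≤ r) (v : ℝ)
    (hv : v = β * bcoef α (M+1) * ((2:ℝ)^(2*(M+1)))⁻¹) (η : Fin (2^(M+1)) → ℝ) :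
    4 * v * gibbs α β fh M (Lh M η) (fun σ => (totalSpin M σ)^2)
      + Real.log (Zf α β fh M (Lh M η)) + (-1) * Real.log (Zf α β fh M (Rh M η))
      + -(β * bcoef α (M+1) / r^2 + Real.log r) + (-1) * maxgk α β fh (M+1) r hr η
    ≤ v * gibbs α β fh (M+1) η (fun σ => (totalSpin (M+1) σ)^2) := by
  have hb : 0 < bcoef α (M+1) := Real.rpow_pos_of_pos (by norm_num) _
  have hv0 : 0 < v := by rw [hv]; positivity
  have hr0 : (0:ℝ) < r := by exact_mod_cast hr
  set p1 : (Fin (2^M) → Bool) → ℝ := fun σ => Real.exp (-β * dysonHRF α fh M (Lh M η) σ) with hp1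
  set p2 : (Fin (2^M) → Bool) → ℝ := fun σ => Real.exp (-β * dysonHRF α fh M (Rh M η) σ) with hp2
  set q : (Fin (2^(M+1)) → Bool) → ℝ := fun σ => Real.exp (-β * dysonHRF α fh (M+1) η σ) with hq
  have hqs : ∀ σ, q σ = p1 (Lh M σ) * p2 (Rh M σ) * Real.exp (v * (totalSpin (M+1) σ)^2) := by
    intro σ
    simp only [hq, hp1, hp2]
    rw [HRF_split, ← Real.exp_add, ← Real.exp_add, hv]
    congr 1
    ring
  -- Jensen at level M+1
  have J1 := aux_jensen q (fun σ => -(v * (totalSpin (M+1) σ)^2)) (fun _ => Real.exp_pos _)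
  have e1 : (∑ σ, -(v * (totalSpin (M+1) σ)^2) * q σ) / (∑ σ, q σ)
      = - (v * gibbs α β fh (M+1) η (fun σ => (totalSpin (M+1) σ)^2)) := by
    unfold gibbs
    rw [← mul_div_assoc, ← neg_div, Finset.mul_sum, ← Finset.sum_neg_distrib]
    congr 1
    apply Finset.sum_congr rfl
    intro σ _
    simp only [hq]; ring
  have e2 : ∑ σ, q σ * Real.exp (-(v * (totalSpin (M+1) σ)^2))
      = Zf α β fh M (Lh M η) * Zf α β fh M (Rh M η) := by
    have : ∀ σ, q σ * Real.exp (-(v * (totalSpin (M+1) σ)^2)) = p1 (Lh M σ) * p2 (Rh M σ) := by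
      intro σ
      rw [hqs, mul_assoc, Real.exp_neg, mul_inv_cancel₀ (Real.exp_pos _).ne', mul_one]
    simp_rw [this]
    rw [sum_conf M (fun a b => p1 a * p2 b)]
    unfold Zf
    rw [Finset.sum_mul_sum]
  rw [e1, e2, Real.log_mul (Zf_pos _ _ _ _ _).ne' (Zf_pos _ _ _ _ _).ne'] at J1
  -- Jensen at level M
  have J2 := aux_jensen p1 (fun σ => 2 * v * (totalSpin M σ)^2) (fun _ => Real.exp_pos _)
  have e3 : (∑ σ, 2 * v * (totalSpin M σ)^2 * p1 σ) / (∑ σ, p1 σ)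
      = 2 * v * gibbs α β fh M (Lh M η) (fun σ => (totalSpin M σ)^2) := by
    unfold gibbs
    rw [← mul_div_assoc, Finset.mul_sum]
    congr 1
    apply Finset.sum_congr rfl
    intro σ _
    simp only [hp1]; ring
  have e4 : ∑ σ, p1 σ = Zf α β fh M (Lh M η) := rfl
  rw [e3, e4] at J2
  -- core
  have hblk : ∀ σ : Fin (2^M) → Bool, ∃ k ∈ Finset.Icc 1 r, inBlock (M+1) r k (totalSpin M σ) := by
    intro σ
    have := abs_le.mp (abs_totalSpin M σ)
    exact aux_block M r hr _ this.1 this.2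
  choose κ hκ1 hκ2 using hblk
  set w1 : (Fin (2^M) → Bool) → ℝ := fun σ => p1 σ * Real.exp (2 * v * (totalSpin M σ)^2) with hw1
  set w2 : (Fin (2^M) → Bool) → ℝ := fun σ => p2 σ * Real.exp (2 * v * (totalSpin M σ)^2) with hw2
  have hw1p : ∀ a, 0 < w1 a := fun a => mul_pos (Real.exp_pos _) (Real.exp_pos _)
  have hw2p : ∀ a, 0 < w2 a := fun a => mul_pos (Real.exp_pos _) (Real.exp_pos _)
  have z1 : ∀ k, Zres α β fh (M+1) r k (Lh M η)
      = ∑ a, if inBlock (M+1) r k (totalSpin M a) then w1 a else 0 := by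
    intro k
    unfold Zres
    apply Finset.sum_congr rfl
    intro a _
    simp only [hw1, hp1, ← Real.exp_add, hv]
    simp only [mul_assoc]
    rfl
  have z2 : ∀ k, Zres α β fh (M+1) r k (Rh M η)
      = ∑ a, if inBlock (M+1) r k (totalSpin M a) then w2 a else 0 := by
    intro k
    unfold Zres
    apply Finset.sum_congr rfl
    intro a _
    simp only [hw2, hp2, ← Real.exp_add, hv]
    simp only [mul_assoc]
    rfl
  have K := aux_core w1 w2 hw1p hw2p (fun k a => inBlock (M+1) r k (totalSpin M a)) κ r hκ1 hκ2
    (Real.exp (maxgk α β fh (M+1) r hr η)) (β * bcoef α (M+1) / r^2) (Real.exp_pos _)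
    (by
      intro k hk
      have := Zres_le α β fh M r hr η k hk
      rw [z1, z2] at this
      exact this)
    (fun a b => v * (totalSpin M a - totalSpin M b)^2)
    (by
      intro k a b ha hb'
      obtain ⟨ha1, ha2⟩ := ha
      obtain ⟨hb1, hb2⟩ := hb'
      have h1 : |totalSpin M a - totalSpin M b| ≤ (2:ℝ)^(M+1) / r := by
        rw [abs_le]; constructor <;> linarith
      have h2 : (totalSpin M a - totalSpin M b)^2 ≤ ((2:ℝ)^(M+1) / r)^2 := by
        rw [← sq_abs]; gcongr
      calc v * (totalSpin M a - totalSpin M b)^2 ≤ v * ((2:ℝ)^(M+1) / r)^2 := by gcongr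
        _ = _ := by
          rw [hv, div_pow, ← pow_mul, mul_comm (M+1) 2]
          field_simp)
  have e5 : ∑ a, ∑ b, w1 a * w2 b * Real.exp (-(v * (totalSpin M a - totalSpin M b)^2))
      = ∑ σ, q σ := by
    rw [← sum_conf M (fun a b => w1 a * w2 b *
      Real.exp (-(v * (totalSpin M a - totalSpin M b)^2)))]
    apply Finset.sum_congr rfl
    intro σ _
    rw [hqs, totalSpin_split]
    simp only [hw1, hw2]
    have : Real.exp (v * (totalSpin M (Lh M σ) + totalSpin M (Rh M σ))^2)
      = Real.exp (2 * v * (totalSpin M (Lh M σ))^2) * Real.exp (2 * v * (totalSpin M (Rh M σ))^2)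
        * Real.exp (-(v * (totalSpin M (Lh M σ) - totalSpin M (Rh M σ))^2)) := by
      rw [← Real.exp_add, ← Real.exp_add]; congr 1; ring
    rw [this]; ring
  rw [e5] at K
  have hW : 0 < ∑ a, w1 a := Finset.sum_pos (fun a _ => hw1p a) Finset.univ_nonempty
  have hQ : 0 < ∑ σ, q σ := Finset.sum_pos (fun a _ => Real.exp_pos _) Finset.univ_nonempty
  have hlog := Real.log_le_log (by positivity) K
  rw [Real.log_pow, Real.log_mul (by positivity) hQ.ne', Real.log_mul (by positivity) (by positivity),
    Real.log_mul (by positivity) (by positivity), Real.log_exp, Real.log_exp] at hlog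
  push_cast at hlog
  have e6 : ∑ a, p1 a * Real.exp (2 * v * (totalSpin M a)^2) = ∑ a, w1 a := rfl
  rw [e6] at J2
  linarith

/-- Lemma 3 of the paper (bernoulli random fields): the recurrence inequality for
`f_N = 2^{-2N} E[⟨S_{N,1}²⟩_N]`. -/
theorem rfim_dyson_recurrence_bernoulli (α β fh c d : ℝ) (hα : 1 < α) (hβ : 0 < β)
    (hfh : 0 < fh) (hc : 0 < c) (hd : 0 ≤ d) (N : ℕ) (hN : 1 ≤ N) (r : ℕ) (hr : 1 ≤ r)
    (hr1 : Real.sqrt (c * β^d * bcoef α N) < (r:ℝ))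
    (hr2 : (r:ℝ) ≤ 1 + Real.sqrt (c * β^d * bcoef α N)) :
    fB α β fh N ≥ fB α β fh (N-1)
      - (1/(β * bcoef α N)) * (1/(c * β^(d-1))
        + Real.log (1 + Real.sqrt (c * β^d * bcoef α N))
        + (bernoulliExp (2^N) (maxgk α β fh N r hr))) := by
  obtain ⟨M, rfl⟩ : ∃ M, N = M + 1 := ⟨N - 1, by omega⟩
  rw [Nat.add_sub_cancel]
  have hb : 0 < bcoef α (M+1) := Real.rpow_pos_of_pos (by norm_num) _
  have hr0 : (0:ℝ) < r := by exact_mod_cast hr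
  have hβd : 0 < β^d := Real.rpow_pos_of_pos hβ d
  have hβd1 : 0 < β^(d-1) := Real.rpow_pos_of_pos hβ _
  have hβe : β^d = β^(d-1) * β := by
    rw [Real.rpow_sub_one hβ.ne']; field_simp
  have h1 : β * bcoef α (M+1) / (r:ℝ)^2 ≤ 1/(c * β^(d-1)) := by
    have h2 : c * β^d * bcoef α (M+1) ≤ (r:ℝ)^2 :=
      ((Real.sqrt_lt' hr0).mp hr1).le
    rw [div_le_div_iff₀ (by positivity) (by positivity)]
    rw [hβe] at h2
    linarith
  have h3 : Real.log r ≤ Real.log (1 + Real.sqrt (c * β^d * bcoef α (M+1))) :=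
    Real.log_le_log hr0 hr2
  set v := β * bcoef α (M+1) * ((2:ℝ)^(2*(M+1)))⁻¹ with hv
  have key := exp_mono (2^(M+1)) _ _ (fun η => aux_point α β fh hβ M r hr v hv η)
  rw [exp_add, exp_add, exp_add, exp_add, exp_smul, exp_smul, exp_smul, exp_const, exp_smul,
    exp_L M (fun η => gibbs α β fh M η (fun σ => (totalSpin M σ)^2)),
    exp_L M (fun η => Real.log (Zf α β fh M η)),
    exp_R M (fun η => Real.log (Zf α β fh M η))] at key
  have hm : bernoulliExp (2^(M+1)) (fun η => maxgk α β fh (M+1) r hr η)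
    = bernoulliExp (2^(M+1)) (maxgk α β fh (M+1) r hr) := rfl
  rw [hm] at key
  have f1 : v * bernoulliExp (2^(M+1)) (fun η => gibbs α β fh (M+1) η
      (fun σ => (totalSpin (M+1) σ)^2)) = β * bcoef α (M+1) * fB α β fh (M+1) := by
    unfold fB; rw [hv]; ring
  have f2 : 4 * v * bernoulliExp (2^M) (fun η => gibbs α β fh M η
      (fun σ => (totalSpin M σ)^2)) = β * bcoef α (M+1) * fB α β fh M := by
    unfold fB; rw [hv]
    have : (2:ℝ)^(2*(M+1)) = 4 * 2^(2*M) := by rw [mul_add, pow_add]; norm_num; ring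
    rw [this, mul_inv]; ring
  rw [f1, f2] at key
  have hpos : 0 < β * bcoef α (M+1) := by positivity
  set E := bernoulliExp (2^(M+1)) (maxgk α β fh (M+1) r hr)
  rw [ge_iff_le, sub_le_iff_le_add, ← mul_le_mul_iff_right₀ hpos, mul_add, ← mul_assoc (β * bcoef α (M+1)) (1 / _),
    mul_one_div_cancel hpos.ne', one_mul]
  linarith

end
end

section
/- Fix α > 1, β > 0, h > 0, c > 0, d ≥ 0, and N ≥ 1, and let the random fields be i.i.d. symmetric Bernoulli (P(h_i = 1) = P(h_i = −1) = 1/2). Then E[ max_{1≤k≤r_N} log( Z_{k,1}(h₁)/Z_{k,2}(h₂) ) ] ≤ β h 2^{N/2} · log( (1 + (c β^d b_N)^{1/2}) · (1 + √(2πe)) ). -/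
open MeasureTheory ProbabilityTheory Filter
open scoped Classical

noncomputable section

theorem aux_mgf (n : ℕ) (a : ℝ) (ha : 0 ≤ a) (f : (Fin n → Bool) → ℝ)
    (hf : ∀ x y, |f x - f y| ≤ a * ∑ i, |spin (x i) - spin (y i)|) :
    ((2:ℝ)^n)⁻¹ * ∑ x, Real.exp (f x)
      ≤ Real.exp (((2:ℝ)^n)⁻¹ * ∑ x, f x + n * a^2 / 2) := by
  induction n with
  | zero => simp [Finset.univ_unique]
  | succ n ih =>
    have key : ∀ F : (Fin (n+1) → Bool) → ℝ,
        ∑ x, F x = ∑ x : Fin n → Bool, (F (Fin.cons true x) + F (Fin.cons false x)) := by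
      intro F
      rw [← (Fin.consEquiv (fun _ : Fin (n+1) => Bool)).sum_comp, Fintype.sum_prod_type_right]
      simp [Fin.consEquiv]
    set g : (Fin n → Bool) → ℝ := fun x => (f (Fin.cons true x) + f (Fin.cons false x)) / 2 with hg
    have hgl : ∀ x y, |g x - g y| ≤ a * ∑ i, |spin (x i) - spin (y i)| := by
      intro x y
      have h1 := hf (Fin.cons true x) (Fin.cons true y)
      have h2 := hf (Fin.cons false x) (Fin.cons false y)
      simp only [Fin.sum_univ_succ, Fin.cons_zero, Fin.cons_succ, sub_self, abs_zero, zero_add] at h1 h2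
      rw [abs_le] at *
      simp only [hg]
      constructor <;> linarith [h1.1, h1.2, h2.1, h2.2]
    have h := ih g hgl
    have hstep : ∀ x : Fin n → Bool,
        Real.exp (f (Fin.cons true x)) + Real.exp (f (Fin.cons false x))
          ≤ 2 * Real.exp (a^2/2) * Real.exp (g x) := by
      intro x
      have h1 := hf (Fin.cons true x) (Fin.cons false x)
      simp only [Fin.sum_univ_succ, Fin.cons_zero, Fin.cons_succ, sub_self, abs_zero,
        Finset.sum_const_zero, add_zero] at h1
      have h3 : |spin true - spin false| = 2 := by norm_num [spin]
      rw [h3] at h1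
      set D := (f (Fin.cons true x) - f (Fin.cons false x)) / 2 with hD
      have e1 : f (Fin.cons true x) = g x + D := by simp only [hg, hD]; ring
      have e2 : f (Fin.cons false x) = g x + -D := by simp only [hg, hD]; ring
      have hDa : |D| ≤ a := by rw [hD, abs_div, abs_two]; linarith
      have hD2 : D^2 ≤ a^2 := by rw [← sq_abs D]; gcongr
      have hc : Real.cosh D ≤ Real.exp (a^2/2) :=
        (Real.cosh_le_exp_half_sq D).trans (Real.exp_le_exp.mpr (by linarith))
      rw [e1, e2, Real.exp_add, Real.exp_add]
      rw [Real.cosh_eq] at hc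
      nlinarith [Real.exp_pos (g x)]
    rw [key, key]
    have hm : ((2:ℝ)^(n+1))⁻¹ * ∑ x : Fin n → Bool, (f (Fin.cons true x) + f (Fin.cons false x))
        = ((2:ℝ)^n)⁻¹ * ∑ x, g x := by
      simp only [hg, ← Finset.sum_div]; rw [pow_succ]; field_simp
    rw [hm]
    calc _ ≤ ((2:ℝ)^(n+1))⁻¹ * ∑ x : Fin n → Bool, 2 * Real.exp (a^2/2) * Real.exp (g x) := by
            gcongr; exact hstep _
      _ = Real.exp (a^2/2) * (((2:ℝ)^n)⁻¹ * ∑ x, Real.exp (g x)) := by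
            rw [← Finset.mul_sum, pow_succ]; field_simp
      _ ≤ Real.exp (a^2/2) * Real.exp (((2:ℝ)^n)⁻¹ * ∑ x, g x + n * a^2 / 2) := by gcongr
      _ = _ := by rw [← Real.exp_add]; congr 1; push_cast; ring

theorem aux_spin_abs (b : Bool) : |spin b| = 1 := by cases b <;> simp [spin]

theorem aux_Z_le (α β fh : ℝ) (hβ : 0 < β) (hfh : 0 < fh) (N r k : ℕ)
    (η η' : Fin (2^(N-1)) → ℝ) :
    Zres α β fh N r k η ≤ Real.exp (β * fh * ∑ i, |η i - η' i|) * Zres α β fh N r k η' := by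
  unfold Zres
  rw [Finset.mul_sum]
  refine Finset.sum_le_sum fun σ _ => ?_
  split_ifs
  · rw [← Real.exp_add, Real.exp_le_exp]
    unfold dysonHRF
    have h : ∑ i, η i * spin (σ i) - ∑ i, η' i * spin (σ i) ≤ ∑ i, |η i - η' i| := by
      rw [← Finset.sum_sub_distrib]
      refine Finset.sum_le_sum fun i _ => ?_
      rw [← sub_mul]
      refine (le_abs_self _).trans ?_
      rw [abs_mul, aux_spin_abs, mul_one]
    have := mul_le_mul_of_nonneg_left h (mul_pos hβ hfh).le
    nlinarith
  · simp

theorem aux_Z_nonneg (α β fh : ℝ) (N r k : ℕ) (η : Fin (2^(N-1)) → ℝ) :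
    0 ≤ Zres α β fh N r k η := by
  unfold Zres
  refine Finset.sum_nonneg fun σ _ => ?_
  split_ifs
  · positivity
  · exact le_rfl

theorem aux_Z_zero (α β fh : ℝ) (hβ : 0 < β) (hfh : 0 < fh) (N r k : ℕ)
    (η η' : Fin (2^(N-1)) → ℝ) (h : Zres α β fh N r k η' = 0) : Zres α β fh N r k η = 0 := by
  have := aux_Z_le α β fh hβ hfh N r k η η'
  rw [h, mul_zero] at this
  exact le_antisymm this (aux_Z_nonneg ..)

theorem aux_logZ (α β fh : ℝ) (hβ : 0 < β) (hfh : 0 < fh) (N r k : ℕ)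
    (η η' : Fin (2^(N-1)) → ℝ) :
    |Real.log (Zres α β fh N r k η) - Real.log (Zres α β fh N r k η')|
      ≤ β * fh * ∑ i, |η i - η' i| := by
  have one : ∀ η η' : Fin (2^(N-1)) → ℝ,
      Real.log (Zres α β fh N r k η) - Real.log (Zres α β fh N r k η')
      ≤ β * fh * ∑ i, |η i - η' i| := by
    intro η η'
    by_cases h : Zres α β fh N r k η' = 0
    · rw [h, aux_Z_zero α β fh hβ hfh N r k η η' h]
      simp only [sub_self]
      positivity
    · have h2 : Zres α β fh N r k η ≠ 0 := fun h2 => h (aux_Z_zero α β fh hβ hfh N r k η' η h2)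
      have := Real.log_le_log (lt_of_le_of_ne (aux_Z_nonneg ..) h2.symm)
        (aux_Z_le α β fh hβ hfh N r k η η')
      rw [Real.log_mul (Real.exp_pos _).ne' h, Real.log_exp] at this
      linarith
  rw [abs_le]
  have h1 := one η η'
  have h2 := one η' η
  simp only [abs_sub_comm (η' _)] at h2
  constructor <;> linarith

theorem aux_gk (α β fh : ℝ) (hβ : 0 < β) (hfh : 0 < fh) (N r k : ℕ) (η : Fin (2^N) → ℝ) :
    gk α β fh N r k η = Real.log (Zres α β fh N r k (half1 N η))
      - Real.log (Zres α β fh N r k (half2 N η)) := by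
  unfold gk
  by_cases h : Zres α β fh N r k (half2 N η) = 0
  · rw [h, aux_Z_zero α β fh hβ hfh N r k _ _ h]; simp
  · exact Real.log_div (fun h2 => h (aux_Z_zero α β fh hβ hfh N r k _ _ h2)) h

theorem aux_sum_half (M : ℕ) (w : Fin (2^(M+1)) → ℝ) :
    ∑ i, w i = ∑ i, half1 (M+1) w i + ∑ i, half2 (M+1) w i := by
  have h : 2^M + 2^M = 2^(M+1) := by ring
  rw [← (finCongr h).sum_comp, Fin.sum_univ_add]
  congr 1
  refine Finset.sum_congr rfl fun i _ => ?_
  have : 2^M + i.1 < 2^(M+1) := by have := i.2; omega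
  simp only [half2, Nat.add_sub_cancel]
  rw [dif_pos this]
  rfl

theorem aux_gk_lip (α β fh : ℝ) (hβ : 0 < β) (hfh : 0 < fh) (M r k : ℕ)
    (η η' : Fin (2^(M+1)) → ℝ) :
    |gk α β fh (M+1) r k η - gk α β fh (M+1) r k η'| ≤ β * fh * ∑ i, |η i - η' i| := by
  rw [aux_gk α β fh hβ hfh, aux_gk α β fh hβ hfh, aux_sum_half M]
  have h1 := aux_logZ α β fh hβ hfh (M+1) r k (half1 (M+1) η) (half1 (M+1) η')
  have h2 := aux_logZ α β fh hβ hfh (M+1) r k (half2 (M+1) η) (half2 (M+1) η')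
  have e1 : ∑ i, half1 (M+1) (fun i => |η i - η' i|) i
      = ∑ i, |half1 (M+1) η i - half1 (M+1) η' i| := rfl
  have e2 : ∑ i, half2 (M+1) (fun i => |η i - η' i|) i
      = ∑ i, |half2 (M+1) η i - half2 (M+1) η' i| := by
    refine Finset.sum_congr rfl fun i _ => ?_
    simp only [half2]
    split_ifs <;> simp
  rw [e1, e2, mul_add]
  rw [abs_le] at *
  constructor <;> linarith [h1.1, h1.2, h2.1, h2.2]

def auxSwapFun (M : ℕ) (i : Fin (2^(M+1))) : Fin (2^(M+1)) :=
  if h : i.1 < 2^M then ⟨2^M + i.1, by have := pow_succ 2 M; omega⟩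
  else ⟨i.1 - 2^M, by have := i.2; omega⟩

theorem auxSwap_inv (M : ℕ) : Function.Involutive (auxSwapFun M) := by
  intro i
  have hi := i.2
  have hp := pow_succ 2 M
  unfold auxSwapFun
  by_cases h : i.1 < 2^M
  · simp [h]
  · have : i.1 - 2^M < 2^M := by omega
    simp only [h, dif_neg, not_false_eq_true, this, dif_pos]
    ext; simp; omega

theorem aux_half1_swap (M : ℕ) (η : Fin (2^(M+1)) → ℝ) :
    half1 (M+1) (fun i => η (auxSwapFun M i)) = half2 (M+1) η := by
  funext i
  have hi : i.1 < 2^M := i.2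
  have : 2^M + i.1 < 2^(M+1) := by rw [pow_succ]; omega
  simp only [half1, half2, auxSwapFun, Nat.add_sub_cancel]
  rw [dif_pos hi, dif_pos this]

theorem aux_half2_swap (M : ℕ) (η : Fin (2^(M+1)) → ℝ) :
    half2 (M+1) (fun i => η (auxSwapFun M i)) = half1 (M+1) η := by
  have := aux_half1_swap M (fun i => η (auxSwapFun M i))
  simp only [auxSwap_inv M _] at this
  exact this.symm

theorem aux_mean (α β fh : ℝ) (hβ : 0 < β) (hfh : 0 < fh) (M r k : ℕ) :
    ∑ ε : Fin (2^(M+1)) → Bool, gk α β fh (M+1) r k (fun i => spin (ε i)) = 0 := by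
  have h := (Equiv.arrowCongr (auxSwap_inv M).toPerm (Equiv.refl Bool)).sum_comp
    (fun ε : Fin (2^(M+1)) → Bool => gk α β fh (M+1) r k (fun i => spin (ε i)))
  have h2 : ∀ ε : Fin (2^(M+1)) → Bool, gk α β fh (M+1) r k (fun i => spin (ε (auxSwapFun M i)))
      = - gk α β fh (M+1) r k (fun i => spin (ε i)) := by
    intro ε
    rw [aux_gk α β fh hβ hfh, aux_gk α β fh hβ hfh,
      aux_half1_swap M (fun i => spin (ε i)), aux_half2_swap M (fun i => spin (ε i))]
    ring
  have h3 : ∀ ε : Fin (2^(M+1)) → Bool,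
      (Equiv.arrowCongr (auxSwap_inv M).toPerm (Equiv.refl Bool)) ε = fun i => ε (auxSwapFun M i) := by
    intro ε; rfl
  simp only [h3, h2, Finset.sum_neg_distrib] at h
  linarith

/-- Lemma 5 of the paper (bernoulli random fields): bound on the expected maximum of
`log (Z_{k,1}/Z_{k,2})` over `1 ≤ k ≤ r_N`. -/
theorem rfim_dyson_maxlog_bound_bernoulli (α β fh c d : ℝ) (hα : 1 < α) (hβ : 0 < β)
    (hfh : 0 < fh) (hc : 0 < c) (hd : 0 ≤ d) (N : ℕ) (hN : 1 ≤ N) (r : ℕ) (hr : 1 ≤ r)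
    (hr1 : Real.sqrt (c * β^d * bcoef α N) < (r:ℝ))
    (hr2 : (r:ℝ) ≤ 1 + Real.sqrt (c * β^d * bcoef α N)) :
    (bernoulliExp (2^N) (maxgk α β fh N r hr)) ≤
      β * fh * (2:ℝ)^((N:ℝ)/2) *
        Real.log ((1 + Real.sqrt (c * β^d * bcoef α N)) * (1 + Real.sqrt (2 * Real.pi * Real.exp 1))) := by
  obtain ⟨M, rfl⟩ : ∃ M, N = M + 1 := ⟨N - 1, by omega⟩
  set n := M + 1 with hn
  set R := 1 + Real.sqrt (c * β^d * bcoef α n) with hR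
  have hr0 : (1:ℝ) ≤ r := by exact_mod_cast hr
  have hs : (0:ℝ) < (2:ℝ)^((n:ℝ)/2) := by positivity
  set s := (2:ℝ)^((n:ℝ)/2) with hsdef
  have hs2 : s^2 = ((2^n : ℕ) : ℝ) := by
    rw [hsdef, ← Real.rpow_natCast, ← Real.rpow_mul (by norm_num)]
    push_cast
    rw [div_mul_cancel₀ _ (by norm_num), Real.rpow_natCast]
  have hK : 0 < β * fh * s := by positivity
  set t := (β * fh * s)⁻¹ with ht
  have ht0 : 0 < t := by positivity
  -- moment generating function
  have hmgf : ∀ k, ((2:ℝ)^(2^n))⁻¹ * ∑ ε : Fin (2^n) → Bool,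
      Real.exp (t * gk α β fh n r k (fun i => spin (ε i))) ≤ Real.exp (1/2) := by
    intro k
    have h := aux_mgf (2^n) (s⁻¹) (by positivity)
      (fun ε => t * gk α β fh n r k (fun i => spin (ε i))) (by
        intro x y
        rw [← mul_sub, abs_mul, abs_of_pos ht0]
        have h1 := mul_le_mul_of_nonneg_left
          (aux_gk_lip α β fh hβ hfh M r k (fun i => spin (x i)) (fun i => spin (y i))) ht0.le
        refine h1.trans (le_of_eq ?_)
        rw [ht]
        field_simp
        rfl)
    rw [← Finset.mul_sum, hn, aux_mean α β fh hβ hfh M r k, ← hn] at h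
    refine h.trans (le_of_eq ?_)
    congr 1
    rw [← hs2]
    field_simp
    simp
  set A := (r:ℝ) * Real.exp (1/2) with hA
  have hA0 : 0 < A := by positivity
  have hpt : ∀ η, t * maxgk α β fh n r hr η
      ≤ (Real.log A - 1) + A⁻¹ * ∑ k ∈ Finset.Icc 1 r, Real.exp (t * gk α β fh n r k η) := by
    intro η
    obtain ⟨k, hk, hke⟩ := Finset.exists_mem_eq_sup' (Finset.nonempty_Icc.mpr hr)
      (fun k => gk α β fh n r k η)
    have hm : maxgk α β fh n r hr η = gk α β fh n r k η := hke
    rw [hm]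
    have h1 : Real.exp (t * gk α β fh n r k η)
        ≤ ∑ k ∈ Finset.Icc 1 r, Real.exp (t * gk α β fh n r k η) :=
      Finset.single_le_sum (f := fun k => Real.exp (t * gk α β fh n r k η))
        (fun i _ => (Real.exp_pos _).le) hk
    have h2 := Real.log_le_sub_one_of_pos
      (show 0 < A⁻¹ * Real.exp (t * gk α β fh n r k η) by positivity)
    rw [Real.log_mul (by positivity) (by positivity), Real.log_exp, Real.log_inv] at h2
    have h3 := mul_le_mul_of_nonneg_left h1 (inv_pos.mpr hA0).le
    linarith
  have hE : t * bernoulliExp (2^n) (maxgk α β fh n r hr) ≤ Real.log A := by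
    unfold bernoulliExp
    have hcard : ((2:ℝ)^(2^n))⁻¹ * ∑ _ε : Fin (2^n) → Bool, (Real.log A - 1) = Real.log A - 1 := by
      rw [Finset.sum_const, nsmul_eq_mul]
      simp only [Finset.card_univ, Fintype.card_pi, Fintype.card_bool, Finset.prod_const,
        Fintype.card_fin]
      push_cast
      rw [inv_mul_cancel_left₀ (by positivity)]
    calc t * (((2:ℝ)^(2^n))⁻¹ * ∑ ε : Fin (2^n) → Bool, maxgk α β fh n r hr (fun i => spin (ε i)))
        = ((2:ℝ)^(2^n))⁻¹ * ∑ ε : Fin (2^n) → Bool, t * maxgk α β fh n r hr (fun i => spin (ε i)) := by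
          rw [← Finset.mul_sum]; ring
      _ ≤ ((2:ℝ)^(2^n))⁻¹ * ∑ ε : Fin (2^n) → Bool, ((Real.log A - 1) + A⁻¹ *
            ∑ k ∈ Finset.Icc 1 r, Real.exp (t * gk α β fh n r k (fun i => spin (ε i)))) := by
          refine mul_le_mul_of_nonneg_left (Finset.sum_le_sum fun ε _ => hpt _) (by positivity)
      _ = (Real.log A - 1) + A⁻¹ * ∑ k ∈ Finset.Icc 1 r, (((2:ℝ)^(2^n))⁻¹ *
            ∑ ε : Fin (2^n) → Bool, Real.exp (t * gk α β fh n r k (fun i => spin (ε i)))) := by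
          rw [Finset.sum_add_distrib, mul_add, hcard, ← Finset.mul_sum, ← Finset.mul_sum,
            Finset.sum_comm]
          ring
      _ ≤ (Real.log A - 1) + A⁻¹ * ∑ k ∈ Finset.Icc 1 r, Real.exp (1/2) := by
          have := Finset.sum_le_sum (s := Finset.Icc 1 r) fun k _ => hmgf k
          have := mul_le_mul_of_nonneg_left this (inv_pos.mpr hA0).le
          linarith
      _ = Real.log A := by
          rw [Finset.sum_const, Nat.card_Icc, nsmul_eq_mul, Nat.add_sub_cancel, ← hA,
            inv_mul_cancel₀ hA0.ne']
          ring
  have hAle : Real.log A ≤ Real.log (R * (1 + Real.sqrt (2 * Real.pi * Real.exp 1))) := by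
    refine Real.log_le_log hA0 ?_
    have h1 : Real.exp (1/2) ≤ 1 + Real.sqrt (2 * Real.pi * Real.exp 1) := by
      rw [Real.exp_half]
      have : Real.sqrt (Real.exp 1) ≤ Real.sqrt (2 * Real.pi * Real.exp 1) := by
        refine Real.sqrt_le_sqrt ?_
        nlinarith [Real.exp_pos 1, Real.pi_gt_three]
      linarith
    exact mul_le_mul hr2 h1 (Real.exp_pos _).le (by linarith)
  have := mul_le_mul_of_nonneg_left (hE.trans hAle) hK.le
  rwa [← mul_assoc, ht, mul_inv_cancel₀ hK.ne', one_mul] at this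

end
end
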